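/- Let γ > 0. The residual operator R(z) = z - T(z), where T(z) = z - Π_S(z) + M_γ⁻¹(2Π_S(z) - z), is 1-Lipschitz: for all z₁, z₂ ∈ ℝ^{n+m}, ‖R(z₁) - R(z₂)‖ ≤ ‖z₁ - z₂‖. -/

import Mathlib

open Matrix
open scoped InnerProductSpace

noncomputable section

/-- The probability simplex `Δᵈ = {x ∈ ℝᵈ : xᵢ ≥ 0, ∑ᵢ xᵢ = 1}` in Euclidean space. -/
def simplex (d : ℕ) : Set (EuclideanSpace ℝ (Fin d)) :=
  {x | (∀ i, 0 ≤ x i) ∧ ∑ i, x i = 1}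

/-- `S = Δⁿ × Δᵐ ⊆ ℝ^{n+m}`, with coordinates indexed by `Fin n ⊕ Fin m`. -/
def gameSet (n m : ℕ) : Set (EuclideanSpace ℝ (Fin n ⊕ Fin m)) :=
  {z | (∀ i, 0 ≤ z i) ∧ (∑ i : Fin n, z (Sum.inl i)) = 1 ∧ (∑ j : Fin m, z (Sum.inr j)) = 1}

/-- The skew block matrix `K = [[0, A], [-Aᵀ, 0]]`. -/
def Kmat {n m : ℕ} (A : Matrix (Fin n) (Fin m) ℝ) :
    Matrix (Fin n ⊕ Fin m) (Fin n ⊕ Fin m) ℝ :=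
  Matrix.fromBlocks 0 A (-Aᵀ) 0

/-- The block matrix `M_γ = [[I, γA], [-γAᵀ, I]] = I + γK`. -/
def Mmat {n m : ℕ} (A : Matrix (Fin n) (Fin m) ℝ) (γ : ℝ) :
    Matrix (Fin n ⊕ Fin m) (Fin n ⊕ Fin m) ℝ :=
  1 + γ • Kmat A

/-- The game operator `F(x, y) = (A y, -Aᵀ x)`. -/
def Fop {n m : ℕ} (A : Matrix (Fin n) (Fin m) ℝ)
    (z : EuclideanSpace ℝ (Fin n ⊕ Fin m)) : EuclideanSpace ℝ (Fin n ⊕ Fin m) :=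
  Matrix.toEuclideanLin (Kmat A) z

/-- The operator (spectral) norm of a matrix, induced by Euclidean norms. -/
def opNorm {n m : ℕ} (A : Matrix (Fin n) (Fin m) ℝ) : ℝ :=
  ‖LinearMap.toContinuousLinearMap (Matrix.toEuclideanLin A)‖

/-- The duality gap `gap(x, y) = max_{y'∈Δᵐ} xᵀAy' - min_{x'∈Δⁿ} x'ᵀAy`. -/
def gap {n m : ℕ} (A : Matrix (Fin n) (Fin m) ℝ)
    (z : EuclideanSpace ℝ (Fin n ⊕ Fin m)) : ℝ :=
  sSup ((fun y' : EuclideanSpace ℝ (Fin m) =>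
      ∑ i : Fin n, ∑ j : Fin m, z (Sum.inl i) * A i j * y' j) '' simplex m)
    - sInf ((fun x' : EuclideanSpace ℝ (Fin n) =>
      ∑ i : Fin n, ∑ j : Fin m, x' i * A i j * z (Sum.inr j)) '' simplex n)

/-- A nearest-point map onto a convex set is firmly nonexpansive. -/
theorem norm_sq_le_inner_of_nearest {E : Type*} [NormedAddCommGroup E] [InnerProductSpace ℝ E]
    {C : Set E} (hC : Convex ℝ C) {P : E → E}
    (hP : ∀ z, P z ∈ C ∧ ∀ w ∈ C, ‖z - P z‖ ≤ ‖z - w‖) (u v : E) :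
    ‖P u - P v‖ ^ 2 ≤ ⟪P u - P v, u - v⟫_ℝ := by
  have key : ∀ z, ∀ w ∈ C, ⟪z - P z, w - P z⟫_ℝ ≤ 0 := by
    intro z
    have : Nonempty C := ⟨⟨P z, (hP z).1⟩⟩
    refine (norm_eq_iInf_iff_real_inner_le_zero hC (hP z).1).1 (le_antisymm ?_ ?_)
    · exact le_ciInf fun w => (hP z).2 w w.2
    · exact ciInf_le (f := fun w : C => ‖z - w‖)
        ⟨0, by rintro _ ⟨w, rfl⟩; exact norm_nonneg _⟩ ⟨P z, (hP z).1⟩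
  have hu := key u (P v) (hP v).1
  have hv := key v (P u) (hP u).1
  rw [← real_inner_self_eq_norm_sq]
  simp only [inner_sub_left, inner_sub_right] at hu hv ⊢
  linarith [real_inner_comm u (P u), real_inner_comm u (P v), real_inner_comm v (P u),
    real_inner_comm v (P v), real_inner_comm (P u) (P v)]

theorem convex_gameSet (n m : ℕ) : Convex ℝ (gameSet n m) := by
  rintro x ⟨hx, hx₁, hx₂⟩ y ⟨hy, hy₁, hy₂⟩ a b ha hb hab
  refine ⟨fun i => ?_, ?_, ?_⟩
  · simpa using add_nonneg (mul_nonneg ha (hx i)) (mul_nonneg hb (hy i))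
  · simp [Finset.sum_add_distrib, ← Finset.mul_sum, hx₁, hy₁, hab]
  · simp [Finset.sum_add_distrib, ← Finset.mul_sum, hx₂, hy₂, hab]

theorem Kmat_transpose {n m : ℕ} (A : Matrix (Fin n) (Fin m) ℝ) : (Kmat A)ᵀ = -Kmat A := by
  simp [Kmat, Matrix.fromBlocks_transpose, Matrix.fromBlocks_neg]

theorem dotProduct_Mmat_mulVec {n m : ℕ} (A : Matrix (Fin n) (Fin m) ℝ) (γ : ℝ)
    (v : Fin n ⊕ Fin m → ℝ) : v ⬝ᵥ (Mmat A γ *ᵥ v) = v ⬝ᵥ v := by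
  have hK : v ⬝ᵥ (Kmat A *ᵥ v) = 0 := by
    have h : v ⬝ᵥ (Kmat A *ᵥ v) = -(v ⬝ᵥ (Kmat A *ᵥ v)) := by
      conv_lhs => rw [Matrix.dotProduct_mulVec, ← Matrix.mulVec_transpose, Kmat_transpose,
        Matrix.neg_mulVec, neg_dotProduct, dotProduct_comm]
    linarith
  simp [Mmat, Matrix.add_mulVec, Matrix.smul_mulVec, hK]

theorem isUnit_det_Mmat {n m : ℕ} (A : Matrix (Fin n) (Fin m) ℝ) (γ : ℝ) :
    IsUnit (Mmat A γ).det := by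
  rw [isUnit_iff_ne_zero]
  intro h
  obtain ⟨v, hv, hMv⟩ := Matrix.exists_mulVec_eq_zero_iff.2 h
  have := dotProduct_Mmat_mulVec A γ v
  rw [hMv, dotProduct_zero] at this
  exact hv (dotProduct_self_eq_zero.1 this.symm)

/-- The resolvent `M_γ⁻¹` is firmly nonexpansive, with equality because `K` is skew. -/
theorem inner_Mmat_inv_apply {n m : ℕ} (A : Matrix (Fin n) (Fin m) ℝ) (γ : ℝ)
    (w : EuclideanSpace ℝ (Fin n ⊕ Fin m)) :
    ⟪Matrix.toEuclideanLin (Mmat A γ)⁻¹ w, w⟫_ℝ =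
      ‖Matrix.toEuclideanLin (Mmat A γ)⁻¹ w‖ ^ 2 := by
  have h := dotProduct_Mmat_mulVec A γ ((Mmat A γ)⁻¹ *ᵥ w.ofLp)
  rw [Matrix.mulVec_mulVec, Matrix.mul_nonsing_inv _ (isUnit_det_Mmat A γ),
    Matrix.one_mulVec] at h
  rw [← real_inner_self_eq_norm_sq]
  simp only [EuclideanSpace.inner_eq_star_dotProduct, Matrix.toLpLin_apply, star_trivial]
  rwa [dotProduct_comm] at h

theorem drs_residual_one_lipschitz {n m : ℕ} (A : Matrix (Fin n) (Fin m) ℝ)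
    (γ : ℝ) (hγ : 0 < γ)
    (proj : EuclideanSpace ℝ (Fin n ⊕ Fin m) → EuclideanSpace ℝ (Fin n ⊕ Fin m))
    (hproj : ∀ z, proj z ∈ gameSet n m ∧ ∀ w ∈ gameSet n m, ‖z - proj z‖ ≤ ‖z - w‖)
    (T : EuclideanSpace ℝ (Fin n ⊕ Fin m) → EuclideanSpace ℝ (Fin n ⊕ Fin m))
    (hT : ∀ z, T z = z - proj z +
      Matrix.toEuclideanLin (Mmat A γ)⁻¹ ((2 : ℝ) • proj z - z))
    (R : EuclideanSpace ℝ (Fin n ⊕ Fin m) → EuclideanSpace ℝ (Fin n ⊕ Fin m))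
    (hR : ∀ z, R z = z - T z) :
    ∀ z₁ z₂ : EuclideanSpace ℝ (Fin n ⊕ Fin m),
      ‖R z₁ - R z₂‖ ≤ ‖z₁ - z₂‖ := by
  intro z₁ z₂
  have hp := norm_sq_le_inner_of_nearest (convex_gameSet n m) hproj z₁ z₂
  set p := proj z₁ - proj z₂ with hp_def
  set d := z₁ - z₂ with hd_def
  have hj := inner_Mmat_inv_apply A γ ((2 : ℝ) • p - d)
  have hRj : R z₁ - R z₂ = p - Matrix.toEuclideanLin (Mmat A γ)⁻¹ ((2 : ℝ) • p - d) := by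
    rw [hR, hR, hT, hT, hp_def, hd_def]
    simp only [map_sub, map_smul, smul_sub]
    abel
  rw [hRj]
  generalize Matrix.toEuclideanLin (Mmat A γ)⁻¹ ((2 : ℝ) • p - d) = j at hj ⊢
  have hfirm : ‖p - j‖ ^ 2 ≤ ⟪p - j, d⟫_ℝ := by
    rw [norm_sub_sq_real, inner_sub_left p j d]
    rw [inner_sub_right, inner_smul_right, real_inner_comm] at hj
    linarith
  nlinarith [real_inner_le_norm (p - j) d, norm_nonneg (p - j), norm_nonneg d]

end
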